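/- Fix α ∈ ℝ, let κ = min_{m ∈ ℤ} |m + α| and let ε₀ = min{ |m+α| - 3/2 : m ∈ ℤ, |m+α| > 3/2 } (which is strictly positive). For ν ≥ 0, r > 0, t > 0 define P_ν(r,t) = ((2ν+1)/(π t²)) (4r²/t²)^ν ∫₀^1 s^{ν-1/2}(1-s)^{ν-1/2}(1 + 4(r²/t²)s)^{-ν-3/2} ds. Then for every ε ∈ (0, ε₀) there exists a constant C_ε > 0 such that for all m ∈ ℤ, all r > 0 and all t ≥ 1, (1 + r)^{-3 - 2ε} · P_{|m+α|}(r, t) ≤ C_ε · t^{-2 - 2κ} · (|m + α| + 1)^{-1 - ε}. -/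

import Mathlib

open Real MeasureTheory intervalIntegral

/-- The explicit on-diagonal partial-wave kernel of the Aharonov–Bohm relativistic
semigroup: `P ν r t = ((2ν+1)/(πt²)) (4r²/t²)^ν ∫₀^1 s^{ν-1/2}(1-s)^{ν-1/2}
(1+4(r²/t²)s)^{-ν-3/2} ds`. -/
noncomputable def abKernel (ν r t : ℝ) : ℝ :=
  ((2*ν + 1) / (π * t^2)) * (4 * r^2 / t^2) ^ ν *
    ∫ s in (0 : ℝ)..1,
      s ^ (ν - 1/2) * (1 - s) ^ (ν - 1/2) * (1 + 4 * (r^2 / t^2) * s) ^ (-ν - 3/2)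

open Set in
/-- Integrability of the arcsine density. -/
lemma integrableOn_rpow_neg_half_mul_one_sub_rpow_neg_half :
    IntegrableOn (fun s : ℝ => s ^ (-(1/2) : ℝ) * (1 - s) ^ (-(1/2) : ℝ)) (Ioc 0 1) := by
  have h := (Complex.betaIntegral_convergent (u := 1/2) (v := 1/2) (by norm_num)
    (by norm_num)).norm
  rw [intervalIntegrable_iff_integrableOn_Ioc_of_le zero_le_one,
    integrableOn_Ioc_iff_integrableOn_Ioo] at h
  rw [integrableOn_Ioc_iff_integrableOn_Ioo]
  refine h.congr_fun (fun s hs => ?_) measurableSet_Ioo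
  have h1 : (0 : ℝ) < 1 - s := by linarith [hs.2]
  have e : (1 - (s : ℂ)) = ((1 - s : ℝ) : ℂ) := by push_cast; rfl
  simp only [norm_mul, e]
  rw [Complex.norm_cpow_eq_rpow_re_of_pos hs.1, Complex.norm_cpow_eq_rpow_re_of_pos h1]
  norm_num

lemma rpow_mul_abKernel_integrand_le {ν a x s : ℝ} (ha : 0 ≤ a) (haν : a ≤ ν) (hx : 0 < x)
    (hs : 0 < s) (hs1 : s < 1) :
    x ^ ν * (s ^ (ν - 1/2) * (1 - s) ^ (ν - 1/2) * (1 + x * s) ^ (-ν - 3/2)) ≤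
      x ^ a * (s ^ (a - 1/2) * (1 - s) ^ (ν - 1/2)) := by
  have hy : 0 < x * s := mul_pos hx hs
  have h1s : 0 < 1 - s := by linarith
  have e1 : x ^ ν = x ^ a * x ^ (ν - a) := by rw [← rpow_add hx]; ring_nf
  have e2 : s ^ (ν - 1/2) = s ^ (a - 1/2) * s ^ (ν - a) := by rw [← rpow_add hs]; ring_nf
  have key : (x * s) ^ (ν - a) * (1 + x * s) ^ (-ν - 3/2) ≤ 1 := by
    calc (x * s) ^ (ν - a) * (1 + x * s) ^ (-ν - 3/2)
        ≤ (1 + x * s) ^ (ν - a) * (1 + x * s) ^ (-ν - 3/2) := by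
          gcongr
          linarith
      _ = (1 + x * s) ^ (-a - 3/2) := by rw [← rpow_add (by linarith)]; ring_nf
      _ ≤ 1 := rpow_le_one_of_one_le_of_nonpos (by linarith) (by linarith)
  calc _ = x ^ a * (s ^ (a - 1/2) * (1 - s) ^ (ν - 1/2)) *
        ((x * s) ^ (ν - a) * (1 + x * s) ^ (-ν - 3/2)) := by
          rw [mul_rpow hx.le hs.le, e1, e2]; ring
    _ ≤ _ := mul_le_of_le_one_right (by positivity) key

open Set in
/-- Any majorant of the beta density with parameters `a + 1/2`, `ν + 1/2` controls the kernel. -/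
lemma abKernel_le {ν a r t K : ℝ} {G : ℝ → ℝ} (ha : 0 ≤ a) (haν : a ≤ ν) (hr : 0 < r)
    (ht : 0 < t) (hG : IntegrableOn G (Ioc 0 1)) (hK : ∫ s in Ioc (0 : ℝ) 1, G s ≤ K)
    (hle : ∀ s ∈ Ioo (0 : ℝ) 1, s ^ (a - 1/2) * (1 - s) ^ (ν - 1/2) ≤ G s) :
    abKernel ν r t ≤ 2 * (ν + 1) * 4 ^ a * K * r ^ (2 * a) * t ^ (-2 - 2 * a) := by
  set x := 4 * r ^ 2 / t ^ 2 with hx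
  have hx0 : 0 < x := by positivity
  have hxa : x ^ a = 4 ^ a * r ^ (2 * a) * t ^ (-2 * a) := by
    rw [hx, div_rpow (by positivity) (by positivity), mul_rpow (by positivity) (by positivity),
      ← rpow_natCast r 2, ← rpow_natCast t 2, ← rpow_mul hr.le, ← rpow_mul ht.le, neg_mul,
      rpow_neg ht.le]
    rfl
  have hint : x ^ ν * (∫ s in (0 : ℝ)..1,
      s ^ (ν - 1/2) * (1 - s) ^ (ν - 1/2) * (1 + 4 * (r^2 / t^2) * s) ^ (-ν - 3/2)) ≤
      x ^ a * K := by
    calc _ = ∫ s in Ioo (0 : ℝ) 1, x ^ ν *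
          (s ^ (ν - 1/2) * (1 - s) ^ (ν - 1/2) * (1 + x * s) ^ (-ν - 3/2)) := by
          rw [integral_of_le zero_le_one, integral_Ioc_eq_integral_Ioo,
            MeasureTheory.integral_const_mul, hx, mul_div_assoc]
      _ ≤ ∫ s in Ioo (0 : ℝ) 1, x ^ a * G s := by
          refine integral_mono_of_nonneg ?_ ?_ ?_
          · filter_upwards [ae_restrict_mem measurableSet_Ioo] with s hs
            have h1 : (0 : ℝ) < 1 - s := by linarith [hs.2]
            have h2 := hs.1
            positivity
          · exact ((integrableOn_Ioc_iff_integrableOn_Ioo).1 hG).const_mul _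
          · filter_upwards [ae_restrict_mem measurableSet_Ioo] with s hs
            exact (rpow_mul_abKernel_integrand_le ha haν hx0 hs.1 hs.2).trans
              (by gcongr; exact hle s hs)
      _ = x ^ a * ∫ s in Ioc (0 : ℝ) 1, G s := by
          rw [MeasureTheory.integral_const_mul, integral_Ioc_eq_integral_Ioo]
      _ ≤ _ := by gcongr
  have hK0 : 0 ≤ K := by
    refine le_trans ?_ hK
    rw [integral_Ioc_eq_integral_Ioo]
    refine setIntegral_nonneg measurableSet_Ioo fun s hs => le_trans ?_ (hle s hs)
    have h1 : (0 : ℝ) < 1 - s := by linarith [hs.2]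
    have h2 := hs.1
    positivity
  have hν : 0 ≤ ν := ha.trans haν
  have ht2 : t ^ (-2 - 2 * a) = (t ^ 2)⁻¹ * t ^ (-2 * a) := by
    rw [← rpow_natCast t 2, ← rpow_neg ht.le, ← rpow_add ht]
    norm_num [sub_eq_add_neg]
  have hc : (2 * ν + 1) / (π * t ^ 2) ≤ 2 * (ν + 1) * (t ^ 2)⁻¹ := by
    rw [div_eq_mul_inv, mul_inv, ← mul_assoc]
    refine mul_le_mul_of_nonneg_right ?_ (by positivity)
    rw [← div_eq_mul_inv, div_le_iff₀ pi_pos]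
    nlinarith [pi_gt_three]
  unfold abKernel
  rw [mul_assoc]
  calc _ ≤ (2 * ν + 1) / (π * t ^ 2) * (x ^ a * K) := by gcongr
    _ ≤ 2 * (ν + 1) * (t ^ 2)⁻¹ * (x ^ a * K) := by gcongr
    _ = _ := by rw [hxa, ht2]; ring

open Set in
lemma abKernel_le_of_small {ν a r t : ℝ} (ha : 0 ≤ a) (haν : a ≤ ν) (hr : 0 < r) (ht : 0 < t) :
    abKernel ν r t ≤ 2 * (ν + 1) * 4 ^ a *
      (∫ s in Ioc (0 : ℝ) 1, s ^ (-(1/2) : ℝ) * (1 - s) ^ (-(1/2) : ℝ)) *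
      r ^ (2 * a) * t ^ (-2 - 2 * a) := by
  refine abKernel_le ha haν hr ht integrableOn_rpow_neg_half_mul_one_sub_rpow_neg_half le_rfl ?_
  intro s hs
  have h1 : (0 : ℝ) < 1 - s := by linarith [hs.2]
  have h2 := hs.1
  exact mul_le_mul (rpow_le_rpow_of_exponent_ge h2 hs.2.le (by linarith))
    (rpow_le_rpow_of_exponent_ge h1 (by linarith) (by linarith)) (by positivity) (by positivity)

open Set in
lemma abKernel_le_of_large {ν a r t : ℝ} (ha : 0 ≤ a) (haν : a ≤ ν) (hν : 1/2 < ν) (hr : 0 < r)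
    (ht : 0 < t) :
    abKernel ν r t ≤ 2 * (ν + 1) * 4 ^ a *
      ((1 / (ν - 1/2)) ^ (a + 1/2) * Gamma (a + 1/2)) *
      r ^ (2 * a) * t ^ (-2 - 2 * a) := by
  have hν' : 0 < ν - 1/2 := by linarith
  have hI : IntegrableOn (fun s : ℝ => s ^ (a + 1/2 - 1) * exp (-((ν - 1/2) * s))) (Ioi 0) := by
    have := integrableOn_rpow_mul_exp_neg_mul_rpow (p := 1) (s := a + 1/2 - 1) (b := ν - 1/2)
      (by linarith) (by norm_num) hν'
    simpa only [rpow_one, neg_mul] using this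
  refine abKernel_le (G := fun s : ℝ => s ^ (a + 1/2 - 1) * exp (-((ν - 1/2) * s)))
    ha haν hr ht (hI.mono_set Ioc_subset_Ioi_self) ?_ ?_
  · rw [← integral_rpow_mul_exp_neg_mul_Ioi (by linarith : 0 < a + 1/2) hν']
    refine setIntegral_mono_set hI ?_ Ioc_subset_Ioi_self.eventuallyLE
    filter_upwards [ae_restrict_mem measurableSet_Ioi] with s hs
    have : (0 : ℝ) < s := hs
    positivity
  · intro s hs
    have h1 : (0 : ℝ) < 1 - s := by linarith [hs.2]
    have h2 := hs.1
    have e : a + 1/2 - 1 = a - 1/2 := by ring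
    simp only [e]
    gcongr
    calc (1 - s) ^ (ν - 1/2) ≤ exp (-s) ^ (ν - 1/2) := by
          gcongr
          linarith [add_one_le_exp (-s)]
      _ = _ := by rw [← exp_mul]; ring_nf

/-- The values `|m + α|` exceeding `c` stay uniformly away from `c`. -/
lemma exists_gap_abs_int_add (α c : ℝ) :
    ∃ δ > 0, ∀ m : ℤ, c < |(m : ℝ) + α| → δ ≤ |(m : ℝ) + α| - c := by
  refine ⟨min (1 - Int.fract (c - α)) (1 - Int.fract (c + α)),
    lt_min (by linarith [Int.fract_lt_one (c - α)]) (by linarith [Int.fract_lt_one (c + α)]), ?_⟩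
  intro m hm
  rcases lt_abs.1 hm with h | h
  · have h' : ⌊c - α⌋ + 1 ≤ m := Int.floor_lt.2 (by linarith)
    have h'' : (⌊c - α⌋ : ℝ) + 1 ≤ m := by exact_mod_cast h'
    have := Int.self_sub_floor (c - α)
    exact (min_le_left _ _).trans (by linarith [le_abs_self ((m : ℝ) + α)])
  · have h' : ⌊c + α⌋ + 1 ≤ -m := Int.floor_lt.2 (by push_cast; linarith)
    have h'' : (⌊c + α⌋ : ℝ) + 1 ≤ -m := by exact_mod_cast h'
    have := Int.self_sub_floor (c + α)
    exact (min_le_right _ _).trans (by linarith [neg_le_abs ((m : ℝ) + α)])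

lemma one_add_rpow_neg_mul_rpow_le_one {r b c : ℝ} (hr : 0 < r) (hb : 0 ≤ b) (hbc : b ≤ c) :
    (1 + r) ^ (-c) * r ^ b ≤ 1 := by
  calc (1 + r) ^ (-c) * r ^ b ≤ (1 + r) ^ (-c) * (1 + r) ^ b := by
        gcongr
        linarith
    _ = (1 + r) ^ (b - c) := by rw [← rpow_add (by linarith)]; ring_nf
    _ ≤ 1 := rpow_le_one_of_one_le_of_nonpos (by linarith) (by linarith)

/-- Lemma 3.1 (on-diagonal form): with `κ = min_{m∈ℤ}|m+α|` and
`ε₀ = min{|m+α|-3/2 : m∈ℤ, |m+α| > 3/2} > 0`, for every `ε ∈ (0,ε₀)` there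
is `C_ε > 0` such that for all `m ∈ ℤ`, `r > 0` and `t ≥ 1`,
`(1+r)^{-3-2ε} P_{|m+α|}(r,t) ≤ C_ε t^{-2-2κ} (|m+α|+1)^{-1-ε}`. -/
theorem abKernel_weighted_bound (α κ ε₀ : ℝ)
    (hκ : κ = sInf {x : ℝ | ∃ m : ℤ, x = |(m : ℝ) + α|})
    (hε₀ : ε₀ = sInf {x : ℝ | ∃ m : ℤ, 3/2 < |(m : ℝ) + α| ∧ x = |(m : ℝ) + α| - 3/2}) :
    0 < ε₀ ∧
    ∀ ε : ℝ, 0 < ε → ε < ε₀ → ∃ C > (0 : ℝ), ∀ m : ℤ, ∀ r : ℝ, 0 < r → ∀ t : ℝ, 1 ≤ t →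
      (1 + r) ^ (-3 - 2*ε) * abKernel |(m : ℝ) + α| r t
        ≤ C * t ^ (-2 - 2*κ) * (|(m : ℝ) + α| + 1) ^ (-1 - ε) := by
  obtain ⟨δ, hδ, hgap⟩ := exists_gap_abs_int_add α (3/2)
  have hκ_le : ∀ m : ℤ, κ ≤ |(m : ℝ) + α| := fun m => by
    rw [hκ]
    exact csInf_le ⟨0, by rintro _ ⟨m, rfl⟩; exact abs_nonneg _⟩ ⟨m, rfl⟩
  have hκ0 : 0 ≤ κ := by
    rw [hκ]
    exact Real.sInf_nonneg (by rintro _ ⟨m, rfl⟩; exact abs_nonneg _)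
  have hκ1 : κ ≤ 1 := by
    refine (hκ_le (-⌊α⌋)).trans (abs_le.2 ?_)
    push_cast
    constructor <;> linarith [Int.floor_le α, Int.lt_floor_add_one α]
  have hε₀_pos : 0 < ε₀ := by
    rw [hε₀]
    refine hδ.trans_le (le_csInf ?_ ?_)
    · refine ⟨_, ⌈2 - α⌉, ?_, rfl⟩
      exact lt_of_lt_of_le (by linarith [Int.le_ceil (2 - α)]) (le_abs_self _)
    · rintro _ ⟨m, hm, rfl⟩
      exact hgap m hm
  have hε₀_le : ∀ m : ℤ, 3/2 < |(m : ℝ) + α| → ε₀ ≤ |(m : ℝ) + α| - 3/2 := fun m hm => by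
    rw [hε₀]
    exact csInf_le ⟨0, by rintro _ ⟨m, hm, rfl⟩; linarith⟩ ⟨m, hm, rfl⟩
  refine ⟨hε₀_pos, fun ε hε hεε₀ => ?_⟩
  set B := ∫ s in Set.Ioc (0 : ℝ) 1, s ^ (-(1/2) : ℝ) * (1 - s) ^ (-(1/2) : ℝ)
  have hB : 0 ≤ B := setIntegral_nonneg measurableSet_Ioc fun s hs => by
    have h1 : (0 : ℝ) ≤ 1 - s := by linarith [hs.2]
    have h2 := hs.1
    positivity
  set Γ := Gamma (2 + ε)
  have hΓ : 0 < Γ := Gamma_pos_of_pos (by linarith)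
  refine ⟨2 * (5/2) ^ (2 + ε) * (4 ^ κ * B + 4 ^ (3/2 + ε) * Γ), by positivity, ?_⟩
  intro m r hr t ht
  have ht0 : 0 < t := by linarith
  have hκν := hκ_le m
  have hgapν := hε₀_le m
  set ν := |(m : ℝ) + α|
  have hν0 : 0 ≤ ν := abs_nonneg _
  have hν1 : 0 < ν + 1 := by linarith
  have hsplit : (ν + 1) * (ν + 1) ^ (-(2 + ε)) = (ν + 1) ^ (-1 - ε) := by
    rw [← rpow_one_add' hν1.le (by linarith)]
    ring_nf
  have hexp : (-3 - 2 * ε) = -(3 + 2 * ε) := by ring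
  rw [hexp]
  rcases le_or_gt ν (3/2) with hsmall | hlarge
  · have h52 : 1 ≤ (5/2) ^ (2 + ε) * (ν + 1) ^ (-(2 + ε)) := by
      rw [rpow_neg hν1.le, ← div_eq_mul_inv, one_le_div (by positivity)]
      gcongr
      linarith
    calc _ ≤ (1 + r) ^ (-(3 + 2 * ε)) *
          (2 * (ν + 1) * 4 ^ κ * B * r ^ (2 * κ) * t ^ (-2 - 2 * κ)) := by
          gcongr
          exact abKernel_le_of_small hκ0 hκν hr ht0
      _ = ((1 + r) ^ (-(3 + 2 * ε)) * r ^ (2 * κ)) *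
          (2 * (ν + 1) * 4 ^ κ * B * t ^ (-2 - 2 * κ)) := by ring
      _ ≤ 1 * (2 * (ν + 1) * 4 ^ κ * B * t ^ (-2 - 2 * κ)) := by
          gcongr
          exact one_add_rpow_neg_mul_rpow_le_one hr (by linarith) (by linarith)
      _ = 1 * (2 * (4 ^ κ * B + 0) * t ^ (-2 - 2 * κ) * (ν + 1)) := by ring
      _ ≤ ((5/2) ^ (2 + ε) * (ν + 1) ^ (-(2 + ε))) *
          (2 * (4 ^ κ * B + 4 ^ (3/2 + ε) * Γ) * t ^ (-2 - 2 * κ) * (ν + 1)) := by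
          gcongr
          positivity
      _ = _ := by rw [← hsplit]; ring
  · have hν : 3/2 + ε ≤ ν := by linarith [hgapν hlarge]
    have h52 : (1 / (ν - 1/2)) ^ (2 + ε) ≤ (5/2) ^ (2 + ε) * (ν + 1) ^ (-(2 + ε)) := by
      rw [rpow_neg hν1.le, ← inv_rpow hν1.le, ← mul_rpow (by norm_num) (by positivity)]
      have : 0 < ν - 1/2 := by linarith
      gcongr
      rw [← div_eq_mul_inv, div_le_div_iff₀ this hν1]
      linarith
    have htt : t ^ (-2 - 2 * (3/2 + ε)) ≤ t ^ (-2 - 2 * κ) :=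
      rpow_le_rpow_of_exponent_le ht (by linarith)
    have hP := abKernel_le_of_large (by linarith : 0 ≤ 3/2 + ε) hν (by linarith) hr ht0
    rw [show 3/2 + ε + 1/2 = 2 + ε by ring] at hP
    calc _ ≤ (1 + r) ^ (-(3 + 2 * ε)) *
          (2 * (ν + 1) * 4 ^ (3/2 + ε) * ((1 / (ν - 1/2)) ^ (2 + ε) * Γ) *
            r ^ (2 * (3/2 + ε)) * t ^ (-2 - 2 * (3/2 + ε))) := by gcongr
      _ = ((1 + r) ^ (-(3 + 2 * ε)) * r ^ (2 * (3/2 + ε))) *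
          (2 * (ν + 1) * (0 + 4 ^ (3/2 + ε) * Γ) * (1 / (ν - 1/2)) ^ (2 + ε) *
            t ^ (-2 - 2 * (3/2 + ε))) := by ring
      _ ≤ 1 * (2 * (ν + 1) * (4 ^ κ * B + 4 ^ (3/2 + ε) * Γ) *
          ((5/2) ^ (2 + ε) * (ν + 1) ^ (-(2 + ε))) * t ^ (-2 - 2 * κ)) := by
          have : 0 < ν - 1/2 := by linarith
          gcongr
          · exact one_add_rpow_neg_mul_rpow_le_one hr (by linarith) (by linarith)
          · positivity
      _ = _ := by rw [← hsplit]; ring
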